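/- Let f and g each belong to the following family of polynomials in ℝ[x,y]: x³ − y² + ε·x + J with ε ∈ {1, −1} and J ∈ ℝ; x³ − y² + ε with ε ∈ {1, −1}; x³ − y²; x³ − y; x³ − x·y + 1; x³ − x·y; x³ + ε·x + J with ε ∈ {1, −1} and J ≥ 0; x³ + 1; x³. If f ∼ g, then f = g. -/

import Mathlib

open MvPolynomial

/-- The polynomial ring `ℝ[x,y]`, realized as `MvPolynomial (Fin 2) ℝ`
with `X 0 = x` and `X 1 = y`. -/
abbrev P2 : Type := MvPolynomial (Fin 2) ℝ

/-- `f ∼ g` : there are an affine automorphism `θ ∈ Γ₂(ℝ)` (a ring automorphism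
of `ℝ[x,y]` sending `x` and `y` to polynomials of total degree at most 1)
and a nonzero `c ∈ ℝ` with `θ f = c • g`. -/
def AffEquiv (f g : P2) : Prop :=
  ∃ θ : P2 ≃+* P2, (θ (X 0)).totalDegree ≤ 1 ∧ (θ (X 1)).totalDegree ≤ 1 ∧
    ∃ c : ℝ, c ≠ 0 ∧ θ f = C c * g

/-- `f ≈ g` : there are a ring automorphism `φ` of `ℝ[x,y]` and a nonzero
`c ∈ ℝ` with `φ f = c • g`. -/
def AutEquiv (f g : P2) : Prop :=
  ∃ φ : P2 ≃+* P2, ∃ c : ℝ, c ≠ 0 ∧ φ f = C c * g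

/-- The table entries with canonical form `x³`. -/
def FamD (p : P2) : Prop :=
  (∃ e J : ℝ, (e = 1 ∨ e = -1) ∧
    p = X 0 ^ 3 - X 1 ^ 2 + C e * X 0 + C J) ∨
  (∃ e : ℝ, (e = 1 ∨ e = -1) ∧ p = X 0 ^ 3 - X 1 ^ 2 + C e) ∨
  p = X 0 ^ 3 - X 1 ^ 2 ∨
  p = X 0 ^ 3 - X 1 ∨
  p = X 0 ^ 3 - X 0 * X 1 + 1 ∨
  p = X 0 ^ 3 - X 0 * X 1 ∨
  (∃ e J : ℝ, (e = 1 ∨ e = -1) ∧ 0 ≤ J ∧ p = X 0 ^ 3 + C e * X 0 + C J) ∨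
  p = X 0 ^ 3 + 1 ∨
  p = X 0 ^ 3

/-- A bivariate polynomial of total degree at most one evaluates as an affine form. -/
lemma exists_affine_eval_of_totalDegree_le_one {R : Type*} [CommRing R]
    (p : MvPolynomial (Fin 2) R) (hp : p.totalDegree ≤ 1) :
    ∃ a b c : R, ∀ v : Fin 2 → R, eval v p = a * v 0 + b * v 1 + c := by
  refine ⟨coeff (Finsupp.single 0 1) p, coeff (Finsupp.single 1 1) p, coeff 0 p, fun v => ?_⟩
  have key : p = C (coeff (Finsupp.single 0 1) p) * X 0 + C (coeff (Finsupp.single 1 1) p) * X 1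
      + C (coeff 0 p) := by
    ext m
    by_cases hm : 1 < m.degree
    · rw [coeff_eq_zero_of_totalDegree_lt (by
        rw [← Finsupp.degree_apply]; omega)]
      have h0 : m ≠ 0 := by rintro rfl; simp at hm
      have h1 (i : Fin 2) : Finsupp.single i 1 ≠ m := by rintro rfl; simp at hm
      simp [coeff_C_mul, coeff_X, coeff_C, h1, h0.symm]
    · have hd : m 0 + m 1 ≤ 1 := by
        rw [Finsupp.degree_eq_sum, Fin.sum_univ_two] at hm; omega
      have : m = 0 ∨ m = Finsupp.single 0 1 ∨ m = Finsupp.single 1 1 := by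
        rcases Nat.eq_zero_or_pos (m 0) with h | h <;> rcases Nat.eq_zero_or_pos (m 1) with h' | h'
        · left; ext i; fin_cases i <;> simp [h, h']
        · right; right; ext i; fin_cases i <;> simp [h]; omega
        · right; left; ext i; fin_cases i <;> simp [h']; omega
        · omega
      have h0 (i : Fin 2) : (0 : Fin 2 →₀ ℕ) ≠ Finsupp.single i 1 := by
        simp [eq_comm]
      rcases this with rfl | rfl | rfl <;>
        simp [coeff_C_mul, coeff_X, coeff_C, Finsupp.single_left_inj, h0]
  conv_lhs => rw [key]
  simp

/-- A ring endomorphism of `ℝ[x,y]` acts on polynomial functions by substitution. -/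
lemma eval_ringHom_apply {σ τ : Type*} (φ : MvPolynomial σ ℝ →+* MvPolynomial τ ℝ) (v : τ → ℝ)
    (p : MvPolynomial σ ℝ) : eval v (φ p) = eval (fun i => eval v (φ (X i))) p := by
  have h : (eval v).comp φ = eval (fun i => eval v (φ (X i))) := by
    refine ringHom_ext (fun r => ?_) (fun i => by simp)
    have := congrArg (fun ψ : ℝ →+* ℝ => ψ r)
      (Subsingleton.elim (((eval v).comp φ).comp C) (RingHom.id ℝ))
    exact this.trans (eval_C r).symm
  exact congrArg (fun ψ : MvPolynomial σ ℝ →+* ℝ => ψ p) h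

/-- The substitution defined by a ring automorphism of `ℝ[x,y]` is injective on points. -/
lemma injective_eval_ringEquiv {σ τ : Type*} (θ : MvPolynomial σ ℝ ≃+* MvPolynomial τ ℝ) :
    Function.Injective (fun (v : τ → ℝ) (i : σ) => eval v (θ (X i))) := by
  intro v w hvw
  ext j
  have h (u : τ → ℝ) := eval_ringHom_apply (θ : MvPolynomial σ ℝ →+* MvPolynomial τ ℝ) u
    (θ.symm (X j))
  have hv := h v
  have hw := h w
  simp only [RingHom.coe_coe, RingEquiv.apply_symm_apply, eval_X] at hv hw
  rw [hv, hw]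
  exact congrArg (fun u => eval u (θ.symm (X j))) hvw

/-- The polynomial `x³ + αx + J - (βy² + γxy + δy)`. -/
noncomputable def cubicForm (β γ δ α J : ℝ) : MvPolynomial (Fin 2) ℝ :=
  X 0 ^ 3 + C α * X 0 + C J - (C β * X 1 ^ 2 + C γ * (X 0 * X 1) + C δ * X 1)

/-- The parameters of `cubicForm` occurring in the table with canonical form `x³`. -/
def IsTableEntry (β γ δ α J : ℝ) : Prop :=
  (β = 1 ∧ γ = 0 ∧ δ = 0 ∧ (α = 1 ∨ α = -1 ∨ α = 0 ∧ (J = 1 ∨ J = -1 ∨ J = 0))) ∨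
  (β = 0 ∧ γ = 0 ∧ δ = 1 ∧ α = 0 ∧ J = 0) ∨
  (β = 0 ∧ γ = 1 ∧ δ = 0 ∧ α = 0 ∧ (J = 1 ∨ J = 0)) ∨
  (β = 0 ∧ γ = 0 ∧ δ = 0 ∧ ((α = 1 ∨ α = -1) ∧ 0 ≤ J ∨ α = 0 ∧ (J = 1 ∨ J = 0)))

lemma FamD.exists_cubicForm {p : P2} (hp : FamD p) :
    ∃ β γ δ α J : ℝ, IsTableEntry β γ δ α J ∧ p = cubicForm β γ δ α J := by
  rcases hp with ⟨e, J, he, rfl⟩ | ⟨e, he, rfl⟩ | rfl | rfl | rfl | rfl | ⟨e, J, he, hJ, rfl⟩ |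
    rfl | rfl
  · exact ⟨1, 0, 0, e, J, by unfold IsTableEntry; tauto, by simp [cubicForm]; ring⟩
  · exact ⟨1, 0, 0, 0, e, by unfold IsTableEntry; tauto, by simp [cubicForm]; ring⟩
  · exact ⟨1, 0, 0, 0, 0, by simp [IsTableEntry], by simp [cubicForm]⟩
  · exact ⟨0, 0, 1, 0, 0, by simp [IsTableEntry], by simp [cubicForm]⟩
  · exact ⟨0, 1, 0, 0, 1, by simp [IsTableEntry], by simp [cubicForm]; ring⟩
  · exact ⟨0, 1, 0, 0, 0, by simp [IsTableEntry], by simp [cubicForm]⟩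
  · exact ⟨0, 0, 0, e, J, by unfold IsTableEntry; tauto, by simp [cubicForm]⟩
  · exact ⟨0, 0, 0, 0, 1, by simp [IsTableEntry], by simp [cubicForm]⟩
  · exact ⟨0, 0, 0, 0, 0, by simp [IsTableEntry], by simp [cubicForm]⟩

/-- Comparison of coefficients for two cubics related by an affine substitution of
determinant `a * e - b * d`. -/
lemma coeff_relations {a b c d e h k β γ δ α J β' γ' δ' α' J' : ℝ}
    (H : ∀ x y : ℝ, (a * x + b * y + c) ^ 3 + α * (a * x + b * y + c) + J -
        (β * (d * x + e * y + h) ^ 2 + γ * ((a * x + b * y + c) * (d * x + e * y + h)) +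
          δ * (d * x + e * y + h)) =
      k * (x ^ 3 + α' * x + J' - (β' * y ^ 2 + γ' * (x * y) + δ' * y))) :
    b = 0 ∧ a ^ 3 = k ∧ 3 * a ^ 2 * c = β * d ^ 2 + γ * a * d ∧
    2 * β * d * e + γ * a * e = k * γ' ∧ β * e ^ 2 = k * β' ∧
    3 * a * c ^ 2 + α * a - 2 * β * d * h - γ * (a * h + c * d) - δ * d = k * α' ∧
    2 * β * e * h + γ * c * e + δ * e = k * δ' ∧
    c ^ 3 + α * c + J - β * h ^ 2 - γ * c * h - δ * h = k * J' := by
  have h00 := H 0 0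
  have h01 := H 0 1
  have h02 := H 0 (-1)
  have h03 := H 0 2
  have hb : b = 0 := by
    have : b ^ 3 = 0 := by linarith
    exact pow_eq_zero_iff (by norm_num) |>.mp this
  subst hb
  have h10 := H 1 0
  have h20 := H (-1) 0
  have h30 := H 2 0
  have h11 := H 1 1
  clear H
  refine ⟨rfl, ?_, ?_, ?_, ?_, ?_, ?_, ?_⟩ <;> linarith

lemma eq_of_mul_eq_cube_mul {a α α' : ℝ} (ha : a ≠ 0) (hα : α = 1 ∨ α = -1 ∨ α = 0)
    (hα' : α' = 1 ∨ α' = -1 ∨ α' = 0) (h : α * a = a ^ 3 * α') :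
    α = α' ∧ (α = 0 ∨ a ^ 2 = 1) := by
  have h2 : α = a ^ 2 * α' := mul_right_cancel₀ ha (by linarith)
  have hpos : 0 < a ^ 2 := by positivity
  have h1 : α = α' := by
    rcases hα with rfl | rfl | rfl <;> rcases hα' with rfl | rfl | rfl <;> linarith
  subst h1
  refine ⟨rfl, or_iff_not_imp_left.mpr fun h0 => ?_⟩
  exact mul_right_cancel₀ h0 (by linarith)

lemma eq_of_eq_mul_of_eq_one_or_eq_zero {k J J' : ℝ} (hk : k ≠ 0) (hJ : J = 1 ∨ J = 0)
    (hJ' : J' = 1 ∨ J' = 0) (h : J = k * J') : J = J' := by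
  rcases hJ with rfl | rfl <;> rcases hJ' with rfl | rfl <;> simp at h ⊢
  exact hk h.symm

lemma IsTableEntry.eq_of_relations {a c d e h k β γ δ α J β' γ' δ' α' J' : ℝ}
    (hf : IsTableEntry β γ δ α J) (hg : IsTableEntry β' γ' δ' α' J')
    (ha : a ≠ 0) (he : e ≠ 0) (hk : a ^ 3 = k)
    (hxx : 3 * a ^ 2 * c = β * d ^ 2 + γ * a * d)
    (hxy : 2 * β * d * e + γ * a * e = k * γ') (hyy : β * e ^ 2 = k * β')
    (hx : 3 * a * c ^ 2 + α * a - 2 * β * d * h - γ * (a * h + c * d) - δ * d = k * α')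
    (hy : 2 * β * e * h + γ * c * e + δ * e = k * δ')
    (h1 : c ^ 3 + α * c + J - β * h ^ 2 - γ * c * h - δ * h = k * J') :
    β = β' ∧ γ = γ' ∧ δ = δ' ∧ α = α' ∧ J = J' := by
  subst hk
  have ha3 : a ^ 3 ≠ 0 := pow_ne_zero 3 ha
  rcases hf with ⟨rfl, rfl, rfl, hf⟩ | ⟨rfl, rfl, rfl, rfl, rfl⟩ | ⟨rfl, rfl, rfl, rfl, hf⟩ |
      ⟨rfl, rfl, rfl, hf⟩ <;>
    rcases hg with ⟨rfl, rfl, rfl, hg⟩ | ⟨rfl, rfl, rfl, rfl, rfl⟩ | ⟨rfl, rfl, rfl, rfl, hg⟩ |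
      ⟨rfl, rfl, rfl, hg⟩ <;>
    simp [ha, he] at hxx hxy hyy hx hy h1 ⊢
  · subst hxy hy
    have hc : c = 0 := by simpa [ha] using hxx
    subst hc
    have hJ : J = a ^ 3 * J' := by linarith
    have hapos : 0 < a ^ 3 := hyy ▸ by positivity
    obtain ⟨rfl, h0 | h0⟩ := eq_of_mul_eq_cube_mul ha (by tauto) (by tauto)
      (show α * a = a ^ 3 * α' by linarith)
    · subst h0
      refine ⟨rfl, ?_⟩
      norm_num at hf hg
      rcases hf with rfl | rfl | rfl <;> rcases hg with rfl | rfl | rfl <;> linarith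
    · rcases (by simpa using h0 : a = 1 ∨ a = -1) with rfl | rfl
      · exact ⟨rfl, by linarith⟩
      · norm_num at hapos
  · subst hy
    have hJ : J = a ^ 3 * J' := by linarith
    exact eq_of_eq_mul_of_eq_one_or_eq_zero ha3 hf hg hJ
  · exact absurd hyy.symm ha3
  · exact absurd hy.symm ha3
  · exact absurd hxy.symm ha3
  · subst hxx
    have hJ : J = a ^ 3 * J' := by linarith
    obtain ⟨rfl, h0 | h0⟩ := eq_of_mul_eq_cube_mul ha (by tauto) (by tauto)
      (show α * a = a ^ 3 * α' by linarith)
    · subst h0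
      norm_num at hf hg
      exact ⟨rfl, eq_of_eq_mul_of_eq_one_or_eq_zero ha3 hf hg hJ⟩
    · rcases (by simpa using h0 : a = 1 ∨ a = -1) with rfl | rfl
      · exact ⟨rfl, by linarith⟩
      · refine ⟨rfl, ?_⟩
        rcases hf with ⟨hα, hJ0⟩ | ⟨rfl, hf⟩
        · have hα0 : α ≠ 0 := by rcases hα with rfl | rfl <;> norm_num
          have hJ0' : 0 ≤ J' := by tauto
          linarith
        · norm_num at hg
          exact eq_of_eq_mul_of_eq_one_or_eq_zero ha3 hf hg hJ

lemma IsTableEntry.eq_of_affEquiv {β γ δ α J β' γ' δ' α' J' : ℝ}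
    (hf : IsTableEntry β γ δ α J) (hg : IsTableEntry β' γ' δ' α' J')
    (H : AffEquiv (cubicForm β γ δ α J) (cubicForm β' γ' δ' α' J')) :
    β = β' ∧ γ = γ' ∧ δ = δ' ∧ α = α' ∧ J = J' := by
  obtain ⟨θ, hθ0, hθ1, k, hk, hθ⟩ := H
  obtain ⟨a, b, c, h0⟩ := exists_affine_eval_of_totalDegree_le_one _ hθ0
  obtain ⟨d, e, h, h1⟩ := exists_affine_eval_of_totalDegree_le_one _ hθ1
  have hrel (x y : ℝ) := congrArg (eval ![x, y]) hθ
  obtain ⟨rfl, hak, hxx, hxy, hyy, hx, hy, hc⟩ :=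
    coeff_relations (a := a) (b := b) (c := c) (d := d) (e := e) (h := h) (k := k)
      (β := β) (γ := γ) (δ := δ) (α := α) (J := J)
      (β' := β') (γ' := γ') (δ' := δ') (α' := α') (J' := J') (fun x y => by
        have := hrel x y
        rw [← RingEquiv.coe_toRingHom, eval_ringHom_apply] at this
        simpa [cubicForm, h0, h1] using this)
  have ha : a ≠ 0 := by
    rintro rfl
    exact hk (by simpa using hak.symm)
  have he : e ≠ 0 := by
    rintro rfl
    have hinj := @injective_eval_ringEquiv _ _ θ ![0, 0] ![0, 1] (by
      ext i
      fin_cases i <;> simp [h0, h1])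
    simpa using congrFun hinj 1
  exact hf.eq_of_relations hg ha he hak hxx hxy hyy hx hy hc

theorem stmt7 (f g : P2) (hf : FamD f) (hg : FamD g) (h : AffEquiv f g) :
    f = g := by
  obtain ⟨β, γ, δ, α, J, hf', rfl⟩ := hf.exists_cubicForm
  obtain ⟨β', γ', δ', α', J', hg', rfl⟩ := hg.exists_cubicForm
  obtain ⟨rfl, rfl, rfl, rfl, rfl⟩ := hf'.eq_of_affEquiv hg' h
  rfl
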